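/- Let m ≥ 1 and e ≥ 0 be integers, and let R = ℤ[w_0,…,w_m, u_0,…,u_e, v_0,…,v_e] be the polynomial ring over ℤ in these m+2e+3 indeterminates. Let P = Σ_{k=0}^{m} w_k·T^k, Q = Σ_{i=0}^{e} u_i·T^i and S = Σ_{i=0}^{e} v_i·T^i in R[T] be generic polynomials of degrees m, e and e. Then the resultant Res(T·Q − S, P) of the degree-(e+1) polynomial T·Q − S and the degree-m polynomial P (the determinant of their (e+1+m)×(e+1+m) Sylvester matrix) is an irreducible element of R. -/

import Mathlib

/-- The Sylvester matrix of two univariate polynomials `P` and `Q` over a commutative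
ring, where `P` is regarded as a polynomial of (formal) degree `m` and `Q` as a
polynomial of (formal) degree `n`.  It is the `(m+n) × (m+n)` matrix whose first `n`
rows carry the (shifted) coefficients of `P` and whose last `m` rows carry the
(shifted) coefficients of `Q`. -/
def sylvesterMatrix {R : Type*} [CommRing R] (m n : ℕ) (P Q : Polynomial R) :
    Matrix (Fin (m + n)) (Fin (m + n)) R :=
  Matrix.of fun i j =>
    if (i : ℕ) < n then
      if (i : ℕ) ≤ (j : ℕ) then P.coeff ((j : ℕ) - (i : ℕ)) else 0
    else
      if (i : ℕ) - n ≤ (j : ℕ) then Q.coeff ((j : ℕ) - ((i : ℕ) - n)) else 0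

/-- The resultant of `P`, of formal degree `m`, and `Q`, of formal degree `n`:
the determinant of their `(m+n) × (m+n)` Sylvester matrix. -/
def res {R : Type*} [CommRing R] (m n : ℕ) (P Q : Polynomial R) : R :=
  (sylvesterMatrix m n P Q).det

open Polynomial in
/-- The Sylvester determinant `res` agrees with Mathlib's resultant of the swapped pair. -/
theorem res_eq_resultant {R : Type*} [CommRing R] {m n : ℕ} {P Q : R[X]}
    (hP : P.natDegree ≤ m) (hQ : Q.natDegree ≤ n) :
    res m n P Q = resultant Q P n m := by
  have h : sylvesterMatrix m n P Q =
      ((sylvester Q P n m).transpose).submatrix (finCongr (add_comm m n))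
        (finCongr (add_comm m n)) := by
    ext i j
    obtain ⟨i, rfl⟩ := (finCongr (add_comm n m)).surjective i
    induction i using Fin.addCases with
    | left i =>
      have hc : i.val + m < j.val → P.coeff (j.val - i.val) = 0 := fun _ =>
        coeff_eq_zero_of_natDegree_lt (by lia)
      simp [sylvesterMatrix, sylvester]
      grind
    | right i =>
      have hc : i.val + n < j.val → Q.coeff (j.val - i.val) = 0 := fun _ =>
        coeff_eq_zero_of_natDegree_lt (by lia)
      simp [sylvesterMatrix, sylvester]
      grind
  rw [res, h, Matrix.det_submatrix_equiv_self, Matrix.det_transpose, resultant]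

open Polynomial in
/-- After shifting the constant coefficient of `g` by a new variable, the resultant of `f` and `g`
times a power of that variable is the determinant of a linear matrix pencil. -/
theorem X_pow_mul_resultant_map_sub_C_X {A : Type*} [CommRing A] (f g : A[X]) (m n : ℕ) :
    X ^ n * resultant (f.map C) (g.map C - C X) m n =
      ((X : A[X]) • (sylvester f (-1) m n).map C + (sylvester 0 g m n).map C).det := by
  rw [← resultant_C_mul_left, resultant]
  refine congrArg Matrix.det (Matrix.ext fun i j => ?_)
  induction j using Fin.addCases with
  | left j =>
    simp only [sylvester, Matrix.of_apply, Fin.addCases_left, Matrix.add_apply, Matrix.smul_apply,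
      Matrix.map_apply, smul_eq_mul, coeff_sub, coeff_map, coeff_neg, coeff_one, coeff_C]
    split_ifs <;> simp
    ring
  | right j =>
    simp only [sylvester, Matrix.of_apply, Fin.addCases_right, Matrix.add_apply, Matrix.smul_apply,
      Matrix.map_apply, smul_eq_mul, coeff_C_mul, coeff_map, coeff_zero]
    split_ifs <;> simp

open Polynomial in
theorem natDegree_resultant_map_sub_C_X_le {A : Type*} [CommRing A] [IsDomain A] (f g : A[X])
    (m n : ℕ) : (resultant (f.map C) (g.map C - C X) m n).natDegree ≤ m := by
  have h := natDegree_det_X_add_C_le (sylvester f (-1) m n) (sylvester 0 g m n)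
  rw [← X_pow_mul_resultant_map_sub_C_X, Fintype.card_fin] at h
  by_cases h0 : resultant (f.map C) (g.map C - C X) m n = 0
  · simp [h0]
  rw [natDegree_X_pow_mul _ h0] at h
  lia

open Polynomial in
theorem coeff_resultant_map_sub_C_X {A : Type*} [CommRing A] (f g : A[X]) (m n : ℕ) :
    (resultant (f.map C) (g.map C - C X) m n).coeff m = f.coeff m ^ n * (-1) ^ m := by
  have h := coeff_det_X_add_C_card (sylvester f (-1) m n) (sylvester 0 g m n)
  rw [← X_pow_mul_resultant_map_sub_C_X, Fintype.card_fin, coeff_X_pow_mul] at h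
  rw [h, ← resultant_C_right, resultant]
  simp

open Polynomial in
theorem irreducible_X_pow_sub_two {m : ℕ} (hm : 1 ≤ m) : Irreducible (X ^ m - C 2 : ℤ[X]) := by
  have hmonic := monic_X_pow_sub_C (2 : ℤ) (by lia : m ≠ 0)
  have hdeg : (X ^ m - C 2 : ℤ[X]).natDegree = m := natDegree_X_pow_sub_C
  refine IsEisensteinAt.irreducible (𝓟 := Ideal.span {2}) ⟨?_, fun {k} hk => ?_, ?_⟩ ?_
    hmonic.isPrimitive (by lia)
  · rw [hmonic.leadingCoeff, Ideal.mem_span_singleton]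
    norm_num
  · rw [hdeg] at hk
    rw [Ideal.mem_span_singleton, coeff_sub, coeff_X_pow, if_neg hk.ne, coeff_C]
    split_ifs <;> simp
  · rw [Ideal.span_singleton_pow, Ideal.mem_span_singleton, coeff_sub, coeff_X_pow,
      if_neg (by lia), coeff_C_zero]
    norm_num
  · rw [Ideal.span_singleton_prime two_ne_zero]
    exact Int.prime_two

open Polynomial in
theorem sum_fin_C_coeff_mul_X_pow {A : Type*} [Semiring A] {p : A[X]} {n : ℕ}
    (hp : p.natDegree ≤ n) : ∑ k : Fin (n + 1), C (p.coeff k) * X ^ (k : ℕ) = p := by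
  rw [Fin.sum_univ_eq_sum_range (fun k => C (p.coeff k) * X ^ k)]
  exact (p.as_sum_range_C_mul_X_pow' (by lia)).symm

theorem natDegree_sum_fin_C_mul_X_pow_le {A : Type*} [Semiring A] {n : ℕ}
    (c : Fin (n + 1) → A) :
    (∑ k, Polynomial.C (c k) * Polynomial.X ^ (k : ℕ)).natDegree ≤ n :=
  Polynomial.natDegree_sum_le_of_forall_le _ _ fun k _ =>
    (Polynomial.natDegree_C_mul_X_pow_le _ _).trans (by lia)

theorem coeff_sum_fin_C_mul_X_pow {A : Type*} [Semiring A] {n : ℕ}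
    (c : Fin (n + 1) → A) (i : Fin (n + 1)) :
    (∑ k, Polynomial.C (c k) * Polynomial.X ^ (k : ℕ)).coeff i = c i := by
  simp [Polynomial.finsetSum_coeff, Polynomial.coeff_C_mul, Polynomial.coeff_X_pow, Fin.val_inj]

/-- The specialization of the universal coefficient ring sending the generic polynomials of
degrees `m`, `e`, `e` to `p`, `q`, `s`. -/
noncomputable def specializeGeneric {A : Type*} [CommRing A] (m e : ℕ) (p q s : Polynomial A) :
    MvPolynomial (Fin (m + 1) ⊕ Fin (e + 1) ⊕ Fin (e + 1)) ℤ →+* A :=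
  MvPolynomial.eval₂Hom (Int.castRingHom A)
    (Sum.elim (fun k => p.coeff k) (Sum.elim (fun i => q.coeff i) fun i => s.coeff i))

theorem map_specializeGeneric {A B : Type*} [CommRing A] [CommRing B] (f : A →+* B) {m e : ℕ}
    (p q s : Polynomial A) (x : MvPolynomial (Fin (m + 1) ⊕ Fin (e + 1) ⊕ Fin (e + 1)) ℤ) :
    f (specializeGeneric m e p q s x) = specializeGeneric m e (p.map f) (q.map f) (s.map f) x := by
  suffices h : f.comp (specializeGeneric m e p q s) =
      specializeGeneric m e (p.map f) (q.map f) (s.map f) from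
    RingHom.congr_fun h x
  refine MvPolynomial.ringHom_ext (by simp) ?_
  rintro (k | i | i) <;> simp [specializeGeneric]

open Polynomial in
theorem map_specializeGeneric_eq {A : Type*} [CommRing A] {m e : ℕ}
    {P Q S : (MvPolynomial (Fin (m + 1) ⊕ Fin (e + 1) ⊕ Fin (e + 1)) ℤ)[X]}
    (hP : P = ∑ k : Fin (m + 1), C (MvPolynomial.X (Sum.inl k)) * X ^ (k : ℕ))
    (hQ : Q = ∑ i : Fin (e + 1), C (MvPolynomial.X (Sum.inr (Sum.inl i))) * X ^ (i : ℕ))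
    (hS : S = ∑ i : Fin (e + 1), C (MvPolynomial.X (Sum.inr (Sum.inr i))) * X ^ (i : ℕ))
    {p q s : A[X]} (hp : p.natDegree ≤ m) (hq : q.natDegree ≤ e) (hs : s.natDegree ≤ e) :
    P.map (specializeGeneric m e p q s) = p ∧ Q.map (specializeGeneric m e p q s) = q ∧
      S.map (specializeGeneric m e p q s) = s := by
  refine ⟨?_, ?_, ?_⟩
  · simpa [hP, Polynomial.map_sum, specializeGeneric] using sum_fin_C_coeff_mul_X_pow hp
  · simpa [hQ, Polynomial.map_sum, specializeGeneric] using sum_fin_C_coeff_mul_X_pow hq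
  · simpa [hS, Polynomial.map_sum, specializeGeneric] using sum_fin_C_coeff_mul_X_pow hs

open Polynomial in
theorem specializeGeneric_resultant {A : Type*} [CommRing A] {m e : ℕ}
    {P Q S : (MvPolynomial (Fin (m + 1) ⊕ Fin (e + 1) ⊕ Fin (e + 1)) ℤ)[X]}
    (hP : P = ∑ k : Fin (m + 1), C (MvPolynomial.X (Sum.inl k)) * X ^ (k : ℕ))
    (hQ : Q = ∑ i : Fin (e + 1), C (MvPolynomial.X (Sum.inr (Sum.inl i))) * X ^ (i : ℕ))
    (hS : S = ∑ i : Fin (e + 1), C (MvPolynomial.X (Sum.inr (Sum.inr i))) * X ^ (i : ℕ))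
    {p q s : A[X]} (hp : p.natDegree ≤ m) (hq : q.natDegree ≤ e) (hs : s.natDegree ≤ e) :
    specializeGeneric m e p q s (resultant P (X * Q - S) m (e + 1)) =
      resultant p (X * q - s) m (e + 1) := by
  obtain ⟨hP', hQ', hS'⟩ := map_specializeGeneric_eq hP hQ hS hp hq hs
  rw [← resultant_map_map, Polynomial.map_sub, Polynomial.map_mul, map_X, hP', hQ', hS']

open Polynomial in
/-- If the generic coefficients are specialized to themselves, nothing changes. -/
theorem specializeGeneric_self {m e : ℕ}
    {P Q S : (MvPolynomial (Fin (m + 1) ⊕ Fin (e + 1) ⊕ Fin (e + 1)) ℤ)[X]}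
    (hP : P = ∑ k : Fin (m + 1), C (MvPolynomial.X (Sum.inl k)) * X ^ (k : ℕ))
    (hQ : Q = ∑ i : Fin (e + 1), C (MvPolynomial.X (Sum.inr (Sum.inl i))) * X ^ (i : ℕ))
    (hS : S = ∑ i : Fin (e + 1), C (MvPolynomial.X (Sum.inr (Sum.inr i))) * X ^ (i : ℕ)) :
    specializeGeneric m e P Q S = RingHom.id _ := by
  refine MvPolynomial.ringHom_ext (by simp) ?_
  rintro (k | i | i) <;> simp only [specializeGeneric, MvPolynomial.coe_eval₂Hom,
    MvPolynomial.eval₂_X, Sum.elim_inl, Sum.elim_inr, hP, hQ, hS, RingHom.id_apply] <;>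
    exact coeff_sum_fin_C_mul_X_pow _ _

open Polynomial in
theorem X_mul_map_C_sub_map_C_add_C_X {A : Type*} [CommRing A] (q s : A[X]) :
    X * q.map C - (s.map C + C X) = (X * q - s).map C - C X := by
  simp only [Polynomial.map_sub, Polynomial.map_mul, map_X]
  ring

open Polynomial in
/-- Let `ψ : R → R[X]` be a section of evaluation at `t`, and let `r : R` be such that `ψ r` has
degree at most `m`, and its `m`-th coefficient is up to a unit a power of a prime not dividing `r`.
If `ψ r` reduces to an irreducible polynomial of degree `m`, then `r` is irreducible. -/
theorem irreducible_of_irreducible_map_section {R K : Type*} [CommRing R] [IsDomain R]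
    [CommRing K] [IsDomain K] (ψ : R →+* R[X]) (t : R) (hψ : ∀ b, (ψ b).eval t = b)
    (φ : R →+* K) {r w : R} {m n : ℕ} (hdeg : (ψ r).natDegree ≤ m) (hw : Prime w)
    (hlead : (ψ r).coeff m ∣ w ^ n) (hwr : ¬ w ∣ r) (hφ : Irreducible ((ψ r).map φ))
    (hφdeg : ((ψ r).map φ).natDegree = m) : Irreducible r := by
  have key : ∀ a b : R, r = a * b → IsUnit ((ψ b).map φ) → IsUnit b := by
    intro a b hab hunit
    have hr0 : ψ r ≠ 0 := fun h => hφ.ne_zero (by rw [h, Polynomial.map_zero])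
    have hψab : ψ r = ψ a * ψ b := by rw [hab, map_mul]
    obtain ⟨ha0, hb0⟩ := mul_ne_zero_iff.mp (hψab ▸ hr0)
    have hsum := natDegree_mul ha0 hb0
    have hmap : ((ψ r).map φ).natDegree = ((ψ a).map φ).natDegree := by
      have h0 := hφ.ne_zero
      rw [hψab, Polynomial.map_mul] at h0 ⊢
      rw [natDegree_mul (left_ne_zero_of_mul h0) (right_ne_zero_of_mul h0),
        natDegree_eq_zero_of_isUnit hunit, add_zero]
    have hale : ((ψ a).map φ).natDegree ≤ (ψ a).natDegree := natDegree_map_le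
    rw [← hψab] at hsum
    obtain ⟨c, hc⟩ := natDegree_eq_zero.mp (by lia : (ψ b).natDegree = 0)
    have hcb : c = b := by simpa [← hc] using hψ b
    have hdvd : b ∣ w ^ n := by
      refine (Dvd.intro_left ((ψ a).coeff m) ?_).trans hlead
      rw [hψab, ← hc, coeff_mul_C, hcb]
    obtain ⟨i, -, hi⟩ := (dvd_prime_pow hw n).mp hdvd
    rcases i with _ | i
    · exact hi.symm.isUnit (by simp)
    · have hwb : w ∣ b := (dvd_pow_self w i.succ_ne_zero).trans hi.symm.dvd
      exact absurd (hwb.trans (Dvd.intro_left a hab.symm)) hwr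
  refine ⟨fun hr => hφ.not_isUnit ((hr.map ψ).map (mapRingHom φ)), fun a b hab => ?_⟩
  have := hφ.isUnit_or_isUnit (a := (ψ a).map φ) (b := (ψ b).map φ)
    (by rw [hab, map_mul, Polynomial.map_mul])
  exact this.symm.imp (key a b hab) (key b a (hab.trans (mul_comm a b))) |>.symm

/-- For generic univariate polynomials `P`, `Q`, `S` of degrees `m ≥ 1`, `e`, `e`
over `ℤ`, the resultant `Res(T·Q − S, P)` of the degree-`(e+1)` polynomial `T·Q − S`
and the degree-`m` polynomial `P` is irreducible in the universal coefficient ring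
`ℤ[w₀,…,w_m, u₀,…,u_e, v₀,…,v_e]`. -/
theorem resultant_XQ_sub_S_generic_irreducible (m e : ℕ) (hm : 1 ≤ m)
    (P Q S : Polynomial (MvPolynomial (Fin (m + 1) ⊕ Fin (e + 1) ⊕ Fin (e + 1)) ℤ))
    (hP : P = ∑ k : Fin (m + 1),
      Polynomial.C (MvPolynomial.X (Sum.inl k)) * Polynomial.X ^ (k : ℕ))
    (hQ : Q = ∑ i : Fin (e + 1),
      Polynomial.C (MvPolynomial.X (Sum.inr (Sum.inl i))) * Polynomial.X ^ (i : ℕ))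
    (hS : S = ∑ i : Fin (e + 1),
      Polynomial.C (MvPolynomial.X (Sum.inr (Sum.inr i))) * Polynomial.X ^ (i : ℕ)) :
    Irreducible (res (e + 1) m (Polynomial.X * Q - S) P) := by
  have hPd : P.natDegree ≤ m := hP ▸ natDegree_sum_fin_C_mul_X_pow_le _
  have hQd : Q.natDegree ≤ e := hQ ▸ natDegree_sum_fin_C_mul_X_pow_le _
  have hSd : S.natDegree ≤ e := hS ▸ natDegree_sum_fin_C_mul_X_pow_le _
  have hFd : (Polynomial.X * Q - S).natDegree ≤ e + 1 := by
    refine (Polynomial.natDegree_sub_le _ _).trans (max_le ?_ (by lia))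
    refine Polynomial.natDegree_mul_le.trans ?_
    rw [Polynomial.natDegree_X]
    lia
  rw [res_eq_resultant hFd hPd]
  set t : MvPolynomial (Fin (m + 1) ⊕ Fin (e + 1) ⊕ Fin (e + 1)) ℤ :=
    MvPolynomial.X (Sum.inr (Sum.inr 0)) with ht
  set s := (S - Polynomial.C t).map Polynomial.C + Polynomial.C Polynomial.X with hs
  have hsd : s.natDegree ≤ e := by
    refine Polynomial.natDegree_add_le_of_degree_le ?_ (by simp)
    refine Polynomial.natDegree_map_le.trans ?_
    exact Polynomial.natDegree_sub_C.trans_le hSd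
  set ψ := specializeGeneric m e (P.map Polynomial.C) (Q.map Polynomial.C) s with hψ
  have hψr : ψ (Polynomial.resultant P (Polynomial.X * Q - S) m (e + 1)) =
      Polynomial.resultant (P.map Polynomial.C)
        ((Polynomial.X * Q - (S - Polynomial.C t)).map Polynomial.C - Polynomial.C Polynomial.X)
        m (e + 1) := by
    rw [hψ, specializeGeneric_resultant hP hQ hS (Polynomial.natDegree_map_le.trans hPd)
      (Polynomial.natDegree_map_le.trans hQd) hsd]
    rw [hs, X_mul_map_C_sub_map_C_add_C_X]
  have hPm : P.coeff m = MvPolynomial.X (Sum.inl (Fin.last m)) := by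
    rw [hP]
    exact coeff_sum_fin_C_mul_X_pow _ (Fin.last m)
  set p : Polynomial ℤ := Polynomial.X ^ m - Polynomial.C 2 with hp
  have hpd : p.natDegree = m := Polynomial.natDegree_X_pow_sub_C
  have hpm : p.coeff m = 1 := by
    rw [← (Polynomial.monic_X_pow_sub_C (2 : ℤ) (by lia : m ≠ 0)).coeff_natDegree, ← hp, hpd]
  set φ := specializeGeneric m e p 1 0 with hφ
  have hφt : φ t = 0 := by simp [φ, t, specializeGeneric]
  have hφr : (ψ (Polynomial.resultant P (Polynomial.X * Q - S) m (e + 1))).map φ =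
      (-1) ^ m * p := by
    obtain ⟨hP', hQ', hS'⟩ := map_specializeGeneric_eq hP hQ hS hpd.le
      (Polynomial.natDegree_one.trans_le e.zero_le) (Polynomial.natDegree_zero.trans_le e.zero_le)
    rw [← hφ] at hP' hQ' hS'
    have hC : (Polynomial.mapRingHom φ).comp Polynomial.C = Polynomial.C.comp φ :=
      Polynomial.mapRingHom_comp_C φ
    have hF : ((Polynomial.X * Q - (S - Polynomial.C t)).map Polynomial.C -
        Polynomial.C Polynomial.X).map (Polynomial.mapRingHom φ) =
        Polynomial.X - Polynomial.C Polynomial.X := by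
      rw [Polynomial.map_sub, Polynomial.map_map, hC, ← Polynomial.map_map]
      simp [hQ', hS', hφt]
    have hpC : (p.map Polynomial.C).natDegree ≤ m := Polynomial.natDegree_map_le.trans hpd.le
    rw [← Polynomial.coe_mapRingHom, hψr, ← Polynomial.resultant_map_map, hF, Polynomial.map_map,
      hC, ← Polynomial.map_map, hP', add_comm e 1,
      Polynomial.resultant_add_right_deg _ _ _ _ _ (Polynomial.natDegree_X_sub_C_le _),
      Polynomial.resultant_X_sub_C_right _ _ _ hpC, Polynomial.coeff_map, hpm, Polynomial.eval_map,
      Polynomial.eval₂_C_X]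
    simp
  refine irreducible_of_irreducible_map_section ψ t (fun b => ?_) φ
    (w := MvPolynomial.X (Sum.inl (Fin.last m))) (n := e + 1)
    (hψr ▸ natDegree_resultant_map_sub_C_X_le _ _ _ _) MvPolynomial.X_prime ?_ ?_ ?_ ?_
  · have hid (f : Polynomial (MvPolynomial (Fin (m + 1) ⊕ Fin (e + 1) ⊕ Fin (e + 1)) ℤ)) :
        (f.map Polynomial.C).map (Polynomial.evalRingHom t) = f := by
      have hC : (Polynomial.evalRingHom t).comp Polynomial.C = RingHom.id _ :=
        RingHom.ext fun _ => Polynomial.eval_C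
      rw [Polynomial.map_map, hC, Polynomial.map_id]
    rw [← Polynomial.coe_evalRingHom, hψ, map_specializeGeneric, hid, hid, hs, Polynomial.map_add, hid,
      Polynomial.map_C, Polynomial.coe_evalRingHom, Polynomial.eval_X, sub_add_cancel,
      specializeGeneric_self hP hQ hS, RingHom.id_apply]
  · rw [hψr, coeff_resultant_map_sub_C_X, hPm]
    exact (IsUnit.mul_right_dvd (isUnit_one.neg.pow m)).mpr dvd_rfl
  · intro hdvd
    have h := map_dvd (specializeGeneric m e (1 : Polynomial ℤ) (Polynomial.X ^ e) 0) hdvd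
    rw [specializeGeneric_resultant hP hQ hS (Polynomial.natDegree_one.trans_le m.zero_le)
      (Polynomial.natDegree_X_pow_le e) (Polynomial.natDegree_zero.trans_le e.zero_le), sub_zero,
      ← pow_succ', Polynomial.resultant_one_left] at h
    simp [specializeGeneric, Polynomial.coeff_one, show m ≠ 0 by lia] at h
  · rw [hφr]
    exact (irreducible_isUnit_mul (isUnit_one.neg.pow m)).mpr (irreducible_X_pow_sub_two hm)
  · rw [hφr]
    rcases neg_one_pow_eq_or (Polynomial ℤ) m with h | h <;> simp [h, hpd]
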